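/- For all natural numbers n, all a ≥ 1, and all k ≥ 2, there exists a natural number N with the following property: for every indexed family (f_i^j)_{i ∈ I, j < a} of functions f_i^j : ℕ → {0,…,k} with |I| = N, and every m ∈ ℕ such that (a) the set {f_i^j↾l : i ∈ I, j < a, l ≤ m} is a k-tree, and (b) whenever i, s ∈ I and j ≠ t are indices below a with f_i^j↾m = f_s^t↾m, then f_i^j = f_s^t, there exists S ⊆ I with |S| = n such that {f_i^j↾l : i ∈ S, j < a, l ∈ ℕ} is a k-tree. -/

import Mathlib

/-- A tree: a set of finite sequences of naturals closed under initial segments. -/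
def IsTree (T : Set (List ℕ)) : Prop :=
  ∀ σ ∈ T, ∀ n : ℕ, σ.take n ∈ T

/-- The immediate successors of a node `σ` within `T`. -/
def succs (T : Set (List ℕ)) (σ : List ℕ) : Set ℕ :=
  {m : ℕ | σ ++ [m] ∈ T}

/-- The set of all initial segments of a family of functions is a `k`-tree:
it is a tree (closed under initial segments) and every element has at most
`k` immediate successors within the set. -/
def IsInitSegKTree (k : ℕ) (T : Set (List ℕ)) : Prop :=
  IsTree T ∧ ∀ σ ∈ T, (succs T σ).encard ≤ k

/-- The initial segment `f↾n = ⟨f 0, …, f (n-1)⟩`. -/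
def seg (f : ℕ → ℕ) (n : ℕ) : List ℕ :=
  List.ofFn fun i : Fin n => f i

theorem seg_length (g : ℕ → ℕ) (l : ℕ) : (seg g l).length = l := by
  simp [seg]

theorem seg_succ (g : ℕ → ℕ) (l : ℕ) : seg g (l + 1) = seg g l ++ [g l] := by
  unfold seg
  rw [List.ofFn_succ_last]
  rfl

theorem seg_eq_seg_iff {g h : ℕ → ℕ} {l : ℕ} :
    seg g l = seg h l ↔ ∀ p < l, g p = h p := by
  unfold seg
  rw [List.ofFn_inj, funext_iff]
  exact ⟨fun H p hp => H ⟨p, hp⟩, fun H p => H p p.2⟩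

theorem take_seg (g : ℕ → ℕ) (l n : ℕ) : (seg g l).take n = seg g (min n l) := by
  apply List.ext_getElem <;> simp [seg]

theorem seg_append_singleton_eq_seg {g h : ℕ → ℕ} {l l' x : ℕ}
    (H : seg g l ++ [x] = seg h l') : l' = l + 1 ∧ seg g l = seg h l ∧ x = h l := by
  have hl : l' = l + 1 := by
    have := congrArg List.length H
    simp only [List.length_append, seg_length, List.length_singleton] at this
    exact this.symm
  subst hl
  rw [seg_succ] at H
  have := List.append_inj H (by simp [seg_length])
  exact ⟨rfl, this.1, by simpa using this.2⟩

/-- No node has three distinct immediate successors among the initial segments of the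
functions `f i`, `i ∈ S`. -/
def BinaryOn {I : Type} (f : I → ℕ → ℕ) (S : Finset I) : Prop :=
  ∀ s ∈ S, ∀ t ∈ S, ∀ u ∈ S, ∀ l : ℕ,
    (∀ p < l, f s p = f t p) → (∀ p < l, f s p = f u p) →
      f s l = f t l ∨ f s l = f u l ∨ f t l = f u l

theorem BinaryOn.mono {I : Type} {f : I → ℕ → ℕ} {S A : Finset I} (h : BinaryOn f A)
    (hS : S ⊆ A) : BinaryOn f S :=
  fun s hs t ht u hu => h s (hS hs) t (hS ht) u (hS hu)

theorem BinaryOn.insert {I : Type} [DecidableEq I] {f : I → ℕ → ℕ} {S : Finset I}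
    (h : BinaryOn f S) {x : I} {l c : ℕ} (hlt : ∀ i ∈ S, ∀ p < l, f i p = f x p)
    (hc : ∀ i ∈ S, f i l = c) (hx : f x l ≠ c) : BinaryOn f (insert x S) := by
  have key : ∀ t ∈ S, ∀ u ∈ S, ∀ q, (∀ p < q, f t p = f x p) → f t q = f u q ∨ f t q = f x q := by
    intro t ht u hu q hq
    rcases lt_trichotomy q l with hql | rfl | hql
    · exact Or.inr (hlt t ht q hql)
    · exact Or.inl ((hc t ht).trans (hc u hu).symm)
    · exact absurd ((hq l hql).symm.trans (hc t ht)) hx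
  intro s hs t ht u hu q hst hsu
  rw [Finset.mem_insert] at hs ht hu
  rcases hs with rfl | hs <;> rcases ht with rfl | ht <;> rcases hu with rfl | hu
  · exact Or.inl rfl
  · exact Or.inl rfl
  · exact Or.inr (Or.inl rfl)
  · rcases key t ht u hu q fun p hp => (hst p hp).symm with H | H
    · exact Or.inr (Or.inr H)
    · exact Or.inl H.symm
  · exact Or.inr (Or.inr rfl)
  · rcases key s hs u hu q hst with H | H
    · exact Or.inr (Or.inl H)
    · exact Or.inl H
  · rcases key s hs t ht q hsu with H | H
    · exact Or.inl H
    · exact Or.inr (Or.inl H)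
  · exact h s hs t ht u hu q hst hsu

theorem exists_binaryOn_subset {I : Type} {f : I → ℕ → ℕ} {k : ℕ}
    (hf : ∀ i p, f i p ≤ k) (n : ℕ) (A : Finset I) (hA : (n + 1) * (k + 1) ^ n ≤ A.card) :
    ∃ S ⊆ A, S.card = n ∧ BinaryOn f S := by
  classical
  induction n generalizing A with
  | zero => exact ⟨∅, by simp, rfl, by simp [BinaryOn]⟩
  | succ n ih =>
    by_cases hall : ∃ l, ∃ i ∈ A, ∃ j ∈ A, f i l ≠ f j l
    · obtain ⟨i, hi, j, hj, hij⟩ := Nat.find_spec hall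
      have hmin := fun p (hp : p < Nat.find hall) => Nat.find_min hall hp
      generalize Nat.find hall = l at hij hmin
      push Not at hmin
      obtain ⟨c, -, hc⟩ := Finset.exists_le_card_fiber_of_mul_le_card_of_maps_to
        (s := A) (t := Finset.range (k + 1)) (f := fun i => f i l) (n := (n + 1) * (k + 1) ^ n)
        (fun i _ => Finset.mem_range.2 (Nat.lt_succ_of_le (hf i l))) (by simp)
        (le_trans (by
          rw [Finset.card_range, pow_succ]
          nlinarith [Nat.zero_le ((k + 1) ^ n * (k + 1))]) hA)
      obtain ⟨S, hSA, hS, hbin⟩ := ih _ hc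
      obtain ⟨x, hxA, hx⟩ : ∃ x ∈ A, f x l ≠ c := by
        by_contra! H
        exact hij ((H i hi).trans (H j hj).symm)
      have hSc : ∀ i ∈ S, f i l = c := fun i hi => (Finset.mem_filter.1 (hSA hi)).2
      have hSA' : S ⊆ A := hSA.trans (Finset.filter_subset _ _)
      refine ⟨insert x S, Finset.insert_subset hxA hSA', ?_,
        hbin.insert (fun i hi p hp => hmin p hp i (hSA' hi) x hxA) hSc hx⟩
      rw [Finset.card_insert_of_notMem fun h => hx (hSc x h), hS]
    · push Not at hall
      obtain ⟨S, hSA, hS⟩ := Finset.exists_subset_card_eq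
        (le_trans (Nat.le_mul_of_pos_right (n + 1) (by positivity))
          (le_trans (Nat.mul_le_mul_right _ (Nat.le_succ _)) hA))
      exact ⟨S, hSA, hS, fun s hs t ht u _ l _ _ => Or.inl (hall l s (hSA hs) t (hSA ht))⟩

theorem exists_simultaneous_binaryOn {α : Type} (J : Finset α) (k n : ℕ) :
    ∃ N : ℕ, ∀ (I : Type) (f : I → α → ℕ → ℕ), (∀ i j p, f i j p ≤ k) →
      ∀ A : Finset I, N ≤ A.card →
        ∃ S ⊆ A, S.card = n ∧ ∀ j ∈ J, BinaryOn (fun i => f i j) S := by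
  classical
  induction J using Finset.induction_on generalizing n with
  | empty =>
    refine ⟨n, fun I f _ A hA => ?_⟩
    obtain ⟨S, hSA, hS⟩ := Finset.exists_subset_card_eq hA
    exact ⟨S, hSA, hS, by simp⟩
  | insert j J _ ih =>
    obtain ⟨N, hN⟩ := ih ((n + 1) * (k + 1) ^ n)
    refine ⟨N, fun I f hf A hA => ?_⟩
    obtain ⟨B, hBA, hB, hbin⟩ := hN I f hf A hA
    obtain ⟨S, hSB, hS, hj⟩ := exists_binaryOn_subset (fun i => hf i j) n B hB.ge
    refine ⟨S, hSB.trans hBA, hS, fun i hi => ?_⟩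
    rcases Finset.mem_insert.1 hi with rfl | hi
    exacts [hj, (hbin i hi).mono hSB]

theorem stmt4 (n a k : ℕ) (ha : 1 ≤ a) (hk : 2 ≤ k) :
    ∃ N : ℕ, ∀ (I : Type) [Fintype I], Fintype.card I = N →
      ∀ f : I → Fin a → ℕ → ℕ, (∀ i j m, f i j m ≤ k) →
      ∀ m : ℕ,
        IsInitSegKTree k
          {σ : List ℕ | ∃ i : I, ∃ j : Fin a, ∃ l ≤ m, σ = seg (f i j) l} →
        (∀ (i s : I) (j t : Fin a), j ≠ t →
          seg (f i j) m = seg (f s t) m → f i j = f s t) →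
        ∃ S : Finset I, S.card = n ∧
          IsInitSegKTree k
            {σ : List ℕ | ∃ i ∈ S, ∃ j : Fin a, ∃ l : ℕ, σ = seg (f i j) l} := by
  obtain ⟨N, hN⟩ := exists_simultaneous_binaryOn (Finset.univ : Finset (Fin a)) k n
  refine ⟨N, fun I _ hI f hf m htree hsep => ?_⟩
  obtain ⟨S, -, hS, hbin⟩ := hN I f hf Finset.univ (by rw [Finset.card_univ, hI])
  refine ⟨S, hS, ?_, ?_⟩
  · rintro _ ⟨i, hi, j, l, rfl⟩ q
    exact ⟨i, hi, j, _, take_seg _ _ _⟩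
  rintro _ ⟨i, hi, j, l, rfl⟩
  rcases lt_or_ge l m with hlm | hml
  · refine le_trans (Set.encard_le_encard ?_) (htree.2 _ ⟨i, j, l, hlm.le, rfl⟩)
    rintro x ⟨s, -, t, l', H⟩
    obtain ⟨rfl, -⟩ := seg_append_singleton_eq_seg H
    exact ⟨s, t, l + 1, hlm, H⟩
  · refine le_trans (not_lt.1 fun hlt => ?_) (Nat.cast_le.2 hk : ((2 : ℕ) : ℕ∞) ≤ k)
    obtain ⟨U, hU, hU3⟩ := Set.exists_subset_encard_eq
      (show (3 : ℕ∞) ≤ _ from Order.add_one_le_of_lt hlt)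
    obtain ⟨x, y, z, hxy, hxz, hyz, rfl⟩ := Set.encard_eq_three.1 hU3
    have hx := hU (show x ∈ ({x, y, z} : Set ℕ) by simp)
    have hy := hU (show y ∈ ({x, y, z} : Set ℕ) by simp)
    have hz := hU (show z ∈ ({x, y, z} : Set ℕ) by simp)
    obtain ⟨s₁, h₁, t₁, _, H₁⟩ := hx
    obtain ⟨s₂, h₂, t₂, _, H₂⟩ := hy
    obtain ⟨s₃, h₃, t₃, _, H₃⟩ := hz
    obtain ⟨-, e₁, rfl⟩ := seg_append_singleton_eq_seg H₁
    obtain ⟨-, e₂, rfl⟩ := seg_append_singleton_eq_seg H₂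
    obtain ⟨-, e₃, rfl⟩ := seg_append_singleton_eq_seg H₃
    have index_eq : ∀ {s s' t t'}, seg (f s t) l = seg (f s' t') l →
        f s t l ≠ f s' t' l → t = t' := fun {s s' t t'} he hne => by
      by_contra htt
      exact hne (congrFun (hsep s s' t t' htt
        (seg_eq_seg_iff.2 fun p hp => seg_eq_seg_iff.1 he p (hp.trans_le hml))) l)
    obtain rfl := index_eq (e₁.symm.trans e₂) hxy
    obtain rfl := index_eq (e₁.symm.trans e₃) hxz
    rcases hbin t₁ (Finset.mem_univ _) s₁ h₁ s₂ h₂ s₃ h₃ l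
      (seg_eq_seg_iff.1 (e₁.symm.trans e₂)) (seg_eq_seg_iff.1 (e₁.symm.trans e₃)) with H | H | H
    exacts [hxy H, hxz H, hyz H]
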